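/- Let p be an odd prime and let G = (ZMod p) × (ZMod p). The group cohomology of G with coefficients in the trivial G-module ℤ satisfies: H⁰(G; ℤ) ≅ ℤ; H¹(G; ℤ) = 0; for every k ≥ 1, H^{2k}(G; ℤ) ≅ (ZMod p)^{k+1}; and for every k ≥ 1, H^{2k+1}(G; ℤ) ≅ (ZMod p)^{k}. -/

import Mathlib

namespace ZPSq

open CategoryTheory

section ops
variable (k : Type) [CommRing k] (p : ℕ) [NeZero p] (M : Type) [AddCommGroup M] [Module k M]

/-- shift minus one -/
def shiftSub : (ZMod p → M) →ₗ[k] (ZMod p → M) where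
  toFun f a := f (a + 1) - f a
  map_add' f g := by ext a; simp; abel
  map_smul' r f := by ext a; simp [smul_sub]

/-- norm -/
def nrm : (ZMod p → M) →ₗ[k] (ZMod p → M) where
  toFun f _ := ∑ c, f c
  map_add' f g := by ext a; simp [Finset.sum_add_distrib]
  map_smul' r f := by ext a; simp [Finset.smul_sum]

/-- alternating operator -/
def Dop (i : ℕ) : (ZMod p → M) →ₗ[k] (ZMod p → M) :=
  if Even i then nrm k p M else shiftSub k p M

variable {k p M}

lemma Dop_even {i : ℕ} (h : Even i) (f : ZMod p → M) (a : ZMod p) :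
    Dop k p M i f a = ∑ c, f c := by simp [Dop, h, nrm]

lemma Dop_odd {i : ℕ} (h : ¬ Even i) (f : ZMod p → M) (a : ZMod p) :
    Dop k p M i f a = f (a + 1) - f a := by simp [Dop, h, shiftSub]

lemma sum_shift (f : ZMod p → M) (c : ZMod p) : ∑ a, f (a + c) = ∑ a, f a :=
  Fintype.sum_equiv (Equiv.addRight c) _ _ (fun _ => rfl)

lemma Dop_Dop (i : ℕ) (f : ZMod p → M) : Dop k p M i (Dop k p M (i + 1) f) = 0 := by
  ext a
  by_cases h : Even i
  · have h' : ¬ Even (i + 1) := by simpa [Nat.even_add_one] using h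
    simp [Dop_even h, Dop_odd h', Finset.sum_sub_distrib, sum_shift]
  · have h' : Even (i + 1) := by simpa [Nat.even_add_one] using h
    simp [Dop_odd h, Dop_even h']

lemma exists_shift (f : ZMod p → M) (h : ∑ a, f a = 0) : ∃ g : ZMod p → M,
    ∀ a, g (a + 1) - g a = f a := by
  obtain ⟨n, rfl⟩ : ∃ n, p = n + 1 := ⟨p - 1, by have := NeZero.pos p; omega⟩
  refine ⟨fun a => ∑ i ∈ Finset.range a.val, f (i : ZMod (n+1)), fun a => ?_⟩
  have ha : ((a.val : ℕ) : ZMod (n+1)) = a := by simp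
  by_cases hl : a.val + 1 < n + 1
  · have : (a + 1).val = a.val + 1 := by
      have := ZMod.val_add_of_lt (a := a) (b := 1)
      rcases n with _ | n
      · omega
      · have h1 : (1 : ZMod (n + 1 + 1)).val = 1 := rfl
        rw [ZMod.val_add_of_lt (by rw [h1]; exact hl), h1]
    simp only [this, Finset.sum_range_succ, ha]; abel
  · have hv : a.val = n := by have := ZMod.val_lt a; omega
    have h0 : a + 1 = 0 := by
      rw [← ha, hv]; exact_mod_cast ZMod.natCast_self (n+1)
    have hs : ∑ i ∈ Finset.range (n + 1), f (i : ZMod (n+1)) = 0 := by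
      rw [← h, Finset.sum_range]
      exact Finset.sum_congr rfl fun i _ => congrArg f (Fin.cast_val_eq_self i)
    have ha' : ((n : ℕ) : ZMod (n+1)) = a := by rw [← ha]; exact congrArg _ hv.symm
    rw [Finset.sum_range_succ, ha'] at hs
    rw [h0]
    simp only [hv, ZMod.val_zero, Finset.range_zero, Finset.sum_empty, zero_sub]
    rw [eq_comm, ← sub_eq_zero, sub_neg_eq_add, add_comm]; exact hs

lemma const_of_shift (f : ZMod p → M) (h : ∀ a, f (a + 1) - f a = 0) (a : ZMod p) :
    f a = f 0 := by
  have : ∀ n : ℕ, f (n : ZMod p) = f 0 := by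
    intro n
    induction n with
    | zero => simp
    | succ n ih => rw [← ih, ← sub_eq_zero, ← h n]; push_cast; rfl
  simpa using this a.val

lemma Dop_exact (i : ℕ) (f : ZMod p → M) (h : Dop k p M i f = 0) :
    ∃ g, Dop k p M (i + 1) g = f := by
  by_cases hi : Even i
  · have h' : ¬ Even (i + 1) := by simpa [Nat.even_add_one] using hi
    obtain ⟨g, hg⟩ := exists_shift f (by have := congrFun h 0; rwa [Dop_even hi] at this)
    exact ⟨g, by ext a; rw [Dop_odd h', hg]⟩
  · have h' : Even (i + 1) := by simpa [Nat.even_add_one] using hi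
    have := const_of_shift f (fun a => by have := congrFun h a; rwa [Dop_odd hi] at this)
    refine ⟨Pi.single 0 (f 0), ?_⟩
    ext a
    rw [Dop_even h', this a]; simp

end ops

section two
variable {k : Type} [CommRing k] {p : ℕ} [NeZero p]

/-- functions on the group -/
abbrev R (k : Type) (p : ℕ) := ZMod p → ZMod p → k

/-- first-variable operator -/
def D1 (i : ℕ) : R k p →ₗ[k] R k p := Dop k p (ZMod p → k) i

/-- second-variable operator -/
def D2 (i : ℕ) : R k p →ₗ[k] R k p where
  toFun f a := Dop k p k i (f a)
  map_add' f g := by ext a; simp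
  map_smul' r f := by ext1 a; exact map_smul (Dop k p k i) r (f a)

lemma D1_D1 (i : ℕ) (f : R k p) : D1 i (D1 (i + 1) f) = 0 := Dop_Dop i f
lemma D2_D2 (i : ℕ) (f : R k p) : D2 i (D2 (i + 1) f) = 0 := by
  ext1 a; exact Dop_Dop i (f a)

lemma D1_D2 (i j : ℕ) (f : R k p) : D1 i (D2 j f) = D2 j (D1 i f) := by
  ext a b
  have e1 : ∀ f : R k p, D1 i f = Dop k p (ZMod p → k) i f := fun _ => rfl
  have e2 : ∀ (f : R k p) a, D2 j f a = Dop k p k j (f a) := fun _ _ => rfl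
  by_cases hi : Even i <;> by_cases hj : Even j
  · simp only [e1, e2, Dop_even hi, Dop_even hj, Finset.sum_apply]
    exact Finset.sum_comm
  · simp only [e1, e2, Dop_even hi, Dop_odd hj, Finset.sum_apply, Finset.sum_sub_distrib]
  · simp only [e1, e2, Dop_odd hi, Dop_even hj, Pi.sub_apply, Finset.sum_sub_distrib]
  · simp only [e1, e2, Dop_odd hi, Dop_odd hj, Pi.sub_apply]; ring

lemma D1_exact (i : ℕ) (f : R k p) (h : D1 i f = 0) : ∃ g, D1 (i + 1) g = f := Dop_exact i f h

/-- sum over the first variable -/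
def S (f : R k p) : ZMod p → k := ∑ a, f a

lemma S_D2 (j : ℕ) (f : R k p) : S (D2 j f) = Dop k p k j (S f) := by
  simp only [S, map_sum]; rfl

lemma S_D1 (f : R k p) : S (D1 1 f) = 0 := by
  simp only [S, D1, Dop_odd (i := 1) (by decide), Finset.sum_sub_distrib, sum_shift, sub_self]

lemma S_ker (f : R k p) (h : S f = 0) : ∃ g, D1 1 g = f :=
  D1_exact 0 f (by ext1 a; rw [D1, Dop_even (by decide)]; exact h)

lemma S_single (u : ZMod p → k) : S (Pi.single 0 u : R k p) = u := by
  simp [S]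

lemma edge' (n : ℕ) (z : R k p) (h1 : Dop k p k n (S z) = 0) :
    ∃ w1 w0, D1 1 w1 + D2 (n + 1) w0 = z := by
  obtain ⟨u, hu⟩ := Dop_exact _ _ h1
  obtain ⟨w1, hw1⟩ := S_ker (z - D2 (n + 1) (Pi.single 0 u)) (by
    have e : S (z - D2 (n + 1) (Pi.single 0 u)) = S z - S (D2 (n + 1) (Pi.single 0 u)) := by
      simp [S, Finset.sum_sub_distrib]
    rw [e, S_D2, S_single, hu, sub_self])
  exact ⟨w1, Pi.single 0 u, by rw [hw1]; abel⟩

lemma edge (n : ℕ) (z w : R k p) (h : D1 1 w + D2 n z = 0) :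
    ∃ w1 w0, D1 1 w1 + D2 (n + 1) w0 = z := by
  apply edge'
  rw [← S_D2]
  have : S (D1 1 w + D2 n z) = 0 := by rw [h]; simp [S]
  have e : S (D1 1 w + D2 n z) = S (D1 1 w) + S (D2 n z) := by
    simp [S, Finset.sum_add_distrib]
  rw [e, S_D1, zero_add] at this; exact this

lemma edge0 (z : R k p) (h : ∑ a, ∑ b, z a b = 0) :
    ∃ w1 w0, D1 1 w1 + D2 1 w0 = z := by
  refine edge' 0 z ?_
  ext a
  rw [Dop_even (by decide)]
  simp only [S, Finset.sum_apply]
  rw [Finset.sum_comm, h]; rfl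

/-- total differential -/
def dT (n : ℕ) : (Fin (n + 2) → R k p) →ₗ[k] (Fin (n + 1) → R k p) where
  toFun z i := D1 (i + 1) (z i.succ) + (-1 : k) ^ (i : ℕ) • D2 (n + 1 - i) (z i.castSucc)
  map_add' f g := by ext1 a; simp; abel
  map_smul' r f := by
    ext1 a
    simp only [Pi.smul_apply, map_smul, RingHom.id_apply, smul_add]
    rw [smul_comm r]

lemma dT_apply (n : ℕ) (z : Fin (n + 2) → R k p) (i : Fin (n + 1)) :
    dT n z i = D1 (i + 1) (z i.succ) + (-1 : k) ^ (i : ℕ) • D2 (n + 1 - i) (z i.castSucc) := rfl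

lemma dT_dT (n : ℕ) (z : Fin (n + 3) → R k p) : dT n (dT (n + 1) z) = 0 := by
  ext1 i
  have hi := i.2
  simp only [dT_apply, map_add, map_smul, Fin.val_succ, Fin.val_castSucc, D1_D1, zero_add]
  have e : n + 1 + 1 - (i : ℕ) = (n + 1 - i) + 1 := by omega
  have e' : n + 1 + 1 - ((i : ℕ) + 1) = (n + 1 - i) := by omega
  rw [e, e', D2_D2, D1_D2, Fin.succ_castSucc, pow_succ]
  simp

lemma dT_exact (n : ℕ) (z : Fin (n + 2) → R k p) (h : dT n z = 0) : ∃ w, dT (n + 1) w = z := by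
  -- extend by zero to natural indices
  let Z : ℕ → R k p := fun i => if h : i < n + 2 then z ⟨i, h⟩ else 0
  have hZ : ∀ i, i < n + 1 →
      D1 (i + 1) (Z (i + 1)) + (-1 : k) ^ i • D2 (n + 1 - i) (Z i) = 0 := by
    intro i hi
    have := congrFun h ⟨i, hi⟩
    rw [dT_apply] at this
    simpa [Z, hi, show i < n + 2 by omega] using this
  have key : ∀ m, m ≤ n + 1 → ∃ W : ℕ → R k p, ∀ i ≤ m,
      D1 (i + 1) (W (i + 1)) + (-1 : k) ^ i • D2 (n + 2 - i) (W i) = Z i := by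
    intro m
    induction m with
    | zero =>
      intro _
      obtain ⟨w1, w0, hw⟩ := edge (n + 1) (Z 0) (Z 1) (by simpa using hZ 0 (by omega))
      refine ⟨fun i => if i = 0 then w0 else w1, fun i hi => ?_⟩
      obtain rfl : i = 0 := by omega
      simpa using hw
    | succ m ih =>
      intro hm
      obtain ⟨W, hW⟩ := ih (by omega)
      obtain ⟨g, hg⟩ := D1_exact (m + 1) (Z (m + 1) - (-1 : k) ^ (m + 1) •
          D2 (n + 2 - (m + 1)) (W (m + 1))) (by
        have h1 := hZ m (by omega)
        rw [← hW m le_rfl, map_add, map_smul] at h1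
        have e : n + 2 - m = (n + 1 - m) + 1 := by omega
        have e' : n + 2 - (m + 1) = (n + 1 - m) := by omega
        rw [e, D2_D2, smul_zero, add_zero] at h1
        rw [map_sub, map_smul, e', D1_D2, pow_succ]
        rw [← h1]; simp)
      refine ⟨Function.update W (m + 2) g, fun i hi => ?_⟩
      rcases Nat.lt_or_ge i (m + 1) with hlt | hge
      · rw [Function.update_of_ne (by omega), Function.update_of_ne (by omega)]
        exact hW i (by omega)
      · obtain rfl : i = m + 1 := by omega
        rw [Function.update_self, Function.update_of_ne (by omega), hg]; abel
  obtain ⟨W, hW⟩ := key (n + 1) le_rfl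
  refine ⟨fun i => W i, ?_⟩
  ext1 i
  have := hW i (by omega)
  rw [dT_apply]
  simpa [Z] using this

end two
end ZPSq

namespace ZPSq
open CategoryTheory
section rep
set_option linter.unusedSectionVars false
variable {k : Type} [CommRing k] {p : ℕ} [NeZero p]

/-- the group -/
abbrev GG (p : ℕ) := Multiplicative (ZMod p × ZMod p)

/-- translation representation -/
def rho (k : Type) [CommRing k] (p n : ℕ) : Representation k (GG p) (Fin (n + 1) → R k p) where
  toFun g :=
    { toFun := fun z i a b => z i (a + g.toAdd.1) (b + g.toAdd.2)
      map_add' := fun _ _ => rfl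
      map_smul' := fun _ _ => rfl }
  map_one' := by ext1 z; ext i a b; simp
  map_mul' g h := by ext1 z; ext i a b; simp [add_assoc]

lemma rep_ext {A B : Rep.{0} k (GG p)} {f g : A ⟶ B} (h : ∀ z, f.hom z = g.hom z) : f = g :=
  Rep.hom_ext (Representation.IntertwiningMap.ext (LinearMap.ext h))

lemma rho_apply (n : ℕ) (g : GG p) (z : Fin (n + 1) → R k p) (i a b) :
    rho k p n g z i a b = z i (a + g.toAdd.1) (b + g.toAdd.2) := rfl

/-- modules of the resolution -/
abbrev PP (k : Type) [CommRing k] (p n : ℕ) : Rep.{0} k (GG p) := Rep.of (rho k p n)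

lemma D1_tr (i : ℕ) (f : R k p) (x y : ZMod p) :
    D1 i (fun a b => f (a + x) (b + y)) = fun a b => D1 i f (a + x) (b + y) := by
  ext a b
  by_cases h : Even i
  · simp only [D1, Dop_even h, Finset.sum_apply]
    exact sum_shift (fun c => f c (b + y)) x
  · simp only [D1, Dop_odd h, Pi.sub_apply, add_right_comm]

lemma D2_tr (i : ℕ) (f : R k p) (x y : ZMod p) :
    D2 i (fun a b => f (a + x) (b + y)) = fun a b => D2 i f (a + x) (b + y) := by
  ext a b
  have e2 : ∀ (f : R k p) a, D2 i f a = Dop k p k i (f a) := fun _ _ => rfl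
  by_cases h : Even i
  · simp only [e2, Dop_even h]
    exact sum_shift (fun c => f (a + x) c) y
  · simp only [e2, Dop_odd h, add_right_comm]

/-- differential as a morphism -/
def dR (k : Type) [CommRing k] (p : ℕ) [NeZero p] (n : ℕ) : PP k p (n + 1) ⟶ PP k p n :=
  Rep.ofHom ((dT n).intertwiningMap_of_isIntertwiningMap _ _ (by
    intro g z
    ext i a b
    rw [rho_apply, dT_apply, dT_apply]
    have h1 := D1_tr (i + 1) (z i.succ) g.toAdd.1 g.toAdd.2
    have h2 := D2_tr (n + 1 - i) (z i.castSucc) g.toAdd.1 g.toAdd.2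
    have h1' := congrFun (congrFun h1 a) b
    have h2' := congrFun (congrFun h2 a) b
    simp only [Pi.add_apply, Pi.smul_apply]
    rw [← h1', ← h2']
    rfl))

lemma dR_apply (n : ℕ) (z : Fin (n + 2) → R k p) : (dR k p n).hom z = dT n z := rfl

/-- lift of a family of elements -/
def lft (n : ℕ) (A : Rep.{0} k (GG p)) (c : Fin (n + 1) → A) : PP k p n ⟶ A :=
  Rep.ofHom (LinearMap.intertwiningMap_of_isIntertwiningMap (rho k p n) A.ρ
    { toFun := fun z => ∑ i, ∑ a, ∑ b, z i a b • A.ρ (Multiplicative.ofAdd (-a, -b)) (c i)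
      map_add' := fun z w => by simp [add_smul, Finset.sum_add_distrib]
      map_smul' := fun r z => by simp [mul_smul, Finset.smul_sum] } (by
    intro g z
    simp only [LinearMap.coe_mk, AddHom.coe_mk, map_sum, map_smul, rho_apply]
    refine Finset.sum_congr rfl fun i _ => ?_
    refine Fintype.sum_equiv (Equiv.addRight g.toAdd.1) _ _ fun a => ?_
    refine Fintype.sum_equiv (Equiv.addRight g.toAdd.2) _ _ fun b => ?_
    simp only [Equiv.coe_addRight]
    congr 1
    rw [← Module.End.mul_apply, ← map_mul]
    congr 2
    apply Multiplicative.toAdd.injective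
    ext <;> simp))

lemma lft_apply (n : ℕ) (A : Rep.{0} k (GG p)) (c : Fin (n + 1) → A) (z : Fin (n + 1) → R k p) :
    (lft n A c).hom z = ∑ i, ∑ a, ∑ b, z i a b • A.ρ (Multiplicative.ofAdd (-a, -b)) (c i) := rfl

/-- basis elements -/
def ee (n : ℕ) (i : Fin (n + 1)) : Fin (n + 1) → R k p :=
  Pi.single i (Pi.single 0 (Pi.single 0 1))

lemma ee_apply (n : ℕ) (i j : Fin (n + 1)) (a b : ZMod p) :
    (ee n i : Fin (n + 1) → R k p) j a b = if i = j ∧ a = 0 ∧ b = 0 then 1 else 0 := by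
  by_cases h : j = i
  · subst h
    by_cases ha : a = 0
    · subst ha; simp [ee, Pi.single_apply]
    · simp [ee, Pi.single_apply, ha]
  · simp [ee, h, Ne.symm h]

lemma decomp (n : ℕ) (z : Fin (n + 1) → R k p) :
    z = ∑ i, ∑ a, ∑ b, z i a b • rho k p n (Multiplicative.ofAdd (-a, -b)) (ee n i) := by
  ext j x y
  simp only [Finset.sum_apply, Pi.smul_apply, rho_apply, ee_apply, toAdd_ofAdd, smul_eq_mul,
    mul_ite, mul_one, mul_zero]
  rw [Finset.sum_eq_single j, Finset.sum_eq_single x, Finset.sum_eq_single y]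
  · simp
  · intro b _ hb
    rw [if_neg]; rintro ⟨-, -, h⟩; exact hb (by rw [← sub_eq_add_neg, sub_eq_zero] at h; exact h.symm)
  · simp
  · intro b _ hb
    refine Finset.sum_eq_zero fun c _ => ?_
    rw [if_neg]; rintro ⟨-, h, -⟩; exact hb (by rw [← sub_eq_add_neg, sub_eq_zero] at h; exact h.symm)
  · simp
  · intro i _ hi
    refine Finset.sum_eq_zero fun c _ => Finset.sum_eq_zero fun d _ => ?_
    rw [if_neg]; rintro ⟨h, -, -⟩; exact hi h
  · simp

lemma hom_eq_lft (n : ℕ) (A : Rep.{0} k (GG p)) (f : PP k p n ⟶ A) :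
    f = lft n A (fun i => f.hom (ee n i)) := by
  refine rep_ext fun z => ?_
  change f.hom z = (lft n A (fun i => f.hom (ee n i))).hom z
  rw [lft_apply]
  conv_lhs => rw [decomp n z]
  rw [map_sum]; refine Finset.sum_congr rfl fun i _ => ?_
  rw [map_sum]; refine Finset.sum_congr rfl fun a _ => ?_
  rw [map_sum]; refine Finset.sum_congr rfl fun b _ => ?_
  rw [map_smul]
  congr 1
  exact Rep.hom_comm_apply f _ _

lemma lft_ee (n : ℕ) (A : Rep.{0} k (GG p)) (c : Fin (n + 1) → A) (j : Fin (n + 1)) :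
    (lft n A c).hom (ee n j) = c j := by
  rw [lft_apply, Finset.sum_eq_single j, Finset.sum_eq_single 0, Finset.sum_eq_single 0]
  · have : (Multiplicative.ofAdd ((-0 : ZMod p), (-0 : ZMod p))) = 1 := by
      apply Multiplicative.toAdd.injective; ext <;> simp
    rw [this, ee_apply]; simp
  · intro b _ hb; rw [ee_apply]; simp [hb]
  · simp
  · intro b _ hb; refine Finset.sum_eq_zero fun c _ => ?_
    rw [ee_apply]; simp [hb]
  · simp
  · intro b _ hb; refine Finset.sum_eq_zero fun c _ => Finset.sum_eq_zero fun d _ => ?_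
    rw [ee_apply]; simp [Ne.symm hb]
  · simp

instance (n : ℕ) : Projective (PP k p n) where
  factors {E X} f e he := by
    have hs := (Rep.epi_iff_surjective e).1 he
    choose c hc using fun i => hs (f.hom (ee n i))
    refine ⟨lft n E c, ?_⟩
    rw [hom_eq_lft n X (lft n E c ≫ e), hom_eq_lft n X f]
    congr 1
    funext i
    rw [Rep.hom_comp, Representation.IntertwiningMap.comp_apply, lft_ee, hc]

/-- the chain complex -/
noncomputable def CC (k : Type) [CommRing k] (p : ℕ) [NeZero p] : ChainComplex (Rep.{0} k (GG p)) ℕ :=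
  ChainComplex.of (PP k p) (dR k p) (fun n => by
    exact rep_ext fun z => dT_dT n z)

lemma CC_d (n : ℕ) : (CC k p).d (n + 1) n = dR k p n := ChainComplex.of_d (PP k p) (dR k p) n

lemma CC_d_apply (n : ℕ) (z : Fin (n + 2) → R k p) :
    Rep.Hom.hom (A := PP k p (n + 1)) (B := PP k p n) ((CC k p).d (n + 1) n) z = dT n z := by
  rw [← dR_apply]
  exact congrArg (fun f : PP k p (n + 1) ⟶ PP k p n => f.hom z) (CC_d n)

/-- augmentation -/
def aug (k : Type) [CommRing k] (p : ℕ) [NeZero p] : PP k p 0 ⟶ Rep.trivial k (GG p) k := lft 0 _ (fun _ => (1 : k))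

lemma aug_apply (z : Fin 1 → R k p) : (aug k p).hom z = ∑ a, ∑ b, z 0 a b := by
  change (lft 0 _ _).hom z = _
  rw [lft_apply]
  simp

lemma sum_D1 (i : ℕ) (z : R k p) : ∑ a, ∑ b, D1 i z a b =
    if Even i then p * ∑ a, ∑ b, z a b else 0 := by
  split_ifs with h
  · simp only [D1, Dop_even h, Finset.sum_apply]
    rw [Finset.sum_const, Finset.card_univ, ZMod.card, Finset.sum_comm]; simp
  · simp only [D1, Dop_odd h, Pi.sub_apply, Finset.sum_sub_distrib]
    rw [sum_shift (fun a => ∑ b, z a b), sub_self]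

lemma sum_D2 (i : ℕ) (z : R k p) : ∑ a, ∑ b, D2 i z a b =
    if Even i then p * ∑ a, ∑ b, z a b else 0 := by
  have e2 : ∀ (f : R k p) a, D2 i f a = Dop k p k i (f a) := fun _ _ => rfl
  split_ifs with h
  · simp only [e2, Dop_even h]
    rw [Finset.mul_sum]; simp
  · simp only [e2, Dop_odd h, Finset.sum_sub_distrib]
    simp only [sum_shift, sub_self]

lemma dR_aug : dR k p 0 ≫ aug k p = 0 := by
  refine rep_ext fun z => ?_
  change (aug k p).hom ((dR k p 0).hom z) = 0
  rw [dR_apply, aug_apply]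
  simp only [dT_apply, Pi.add_apply, Pi.smul_apply, Finset.sum_add_distrib, ← Finset.smul_sum]
  rw [sum_D1, sum_D2]; simp

/-- augmentation chain map -/
noncomputable def piC (k : Type) [CommRing k] (p : ℕ) [NeZero p] :
    CC k p ⟶ (ChainComplex.single₀ (Rep.{0} k (GG p))).obj (Rep.trivial k (GG p) k) :=
  ((CC k p).toSingle₀Equiv _).symm ⟨aug k p, by rw [CC_d]; exact dR_aug⟩

lemma piC_f_apply (z : Fin 1 → R k p) :
    Rep.Hom.hom (A := PP k p 0) (B := Rep.trivial k (GG p) k) ((piC k p).f 0) z =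
      (aug k p).hom z := by
  have h : (piC k p).f 0 = aug k p := ChainComplex.toSingle₀Equiv_symm_apply_f_zero _ _
  exact congrArg (fun f : PP k p 0 ⟶ Rep.trivial k (GG p) k => f.hom z) h

lemma piC_quasiIso : QuasiIso (piC k p) where
  quasiIsoAt m := by
    induction m with
    | zero =>
      simp only [piC]
      rw [ChainComplex.quasiIsoAt₀_iff, ShortComplex.quasiIso_iff_of_zeros' _ rfl rfl rfl]
      constructor
      · apply (forget₂ _ (ModuleCat k)).reflects_exact_of_faithful
        rw [ShortComplex.moduleCat_exact_iff]
        intro (z : Fin 1 → R k p) hz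
        have hz' : ∑ a, ∑ b, z 0 a b = 0 := (aug_apply z).symm.trans ((piC_f_apply z).symm.trans hz)
        obtain ⟨w1, w0, hw⟩ := edge0 (z 0) hz'
        refine ⟨(![w0, w1] : Fin 2 → R k p), ?_⟩
        refine (CC_d_apply 0 (![w0, w1] : Fin 2 → R k p)).trans ?_
        ext1 i
        obtain rfl : i = 0 := Subsingleton.elim (α := Fin 1) _ _
        rw [dT_apply, ← hw]; simp
      · rw [Rep.epi_iff_surjective]
        intro (x : k)
        refine ⟨(x • ee 0 0 : Fin 1 → R k p), (piC_f_apply _).trans ?_⟩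
        rw [map_smul]
        change x • (aug k p).hom _ = x
        rw [aug, lft_ee]; simp
    | succ m _ =>
      rw [quasiIsoAt_iff_exactAt' (hL := ChainComplex.exactAt_succ_single_obj ..),
          HomologicalComplex.exactAt_iff' _ (m + 2) (m + 1) m (by simp) (by simp)]
      apply (forget₂ _ (ModuleCat k)).reflects_exact_of_faithful
      rw [ShortComplex.moduleCat_exact_iff]
      intro (z : Fin (m + 2) → R k p) hz
      have hz' : dT m z = 0 := (CC_d_apply m z).symm.trans hz
      obtain ⟨w, hw⟩ := dT_exact m z hz'
      refine ⟨w, ?_⟩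
      exact (CC_d_apply (m + 1) w).trans hw

/-- the resolution -/
noncomputable def res (k : Type) [CommRing k] (p : ℕ) [NeZero p] :
    ProjectiveResolution (Rep.trivial k (GG p) k) where
  complex := CC k p
  projective n := inferInstanceAs (Projective (PP k p n))
  π := piC k p
  quasiIso := piC_quasiIso

end rep
end ZPSq

namespace ZPSq
open CategoryTheory
section coh

lemma homology_equiv {k : Type} [CommRing k] (S : ShortComplex (ModuleCat.{0} k)) {A : Type} [AddCommGroup A] [Module k A]
    (φ : S.X₂ →ₗ[k] A)
    (hs : ∀ a, ∃ x, S.g x = 0 ∧ φ x = a)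
    (hk : ∀ x, S.g x = 0 → (φ x = 0 ↔ ∃ y, S.f y = x)) :
    Nonempty (S.homology ≃+ A) := by
  let φ' : LinearMap.ker S.g.hom →ₗ[k] A := φ ∘ₗ (LinearMap.ker S.g.hom).subtype
  have hφ' : Function.Surjective φ' := by
    intro a
    obtain ⟨x, hx, h⟩ := hs a
    exact ⟨⟨x, hx⟩, h⟩
  have e : LinearMap.range S.moduleCatToCycles = LinearMap.ker φ' := by
    ext ⟨x, hx⟩
    rw [LinearMap.mem_ker]
    refine Iff.trans ?_ (hk x hx).symm
    constructor
    · rintro ⟨y, hy⟩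
      exact ⟨y, congrArg Subtype.val hy⟩
    · rintro ⟨y, hy⟩
      exact ⟨y, Subtype.ext hy⟩
  exact ⟨(S.moduleCatHomologyIso.toLinearEquiv.trans
    ((Submodule.quotEquivOfEq _ _ e).trans (φ'.quotKerEquivOfSurjective hφ'))).toAddEquiv⟩

set_option linter.unusedSectionVars false
variable {k : Type} [CommRing k] {p : ℕ} [NeZero p]

/-- coefficients -/
abbrev ZZ (k : Type) [CommRing k] (p : ℕ) : Rep.{0} k (GG p) := Rep.trivial k (GG p) k

/-- coordinates -/
def evN (n : ℕ) : (PP k p n ⟶ ZZ k p) →ₗ[k] (ℕ → k) where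
  toFun f m := if h : m < n + 1 then f.hom (ee n ⟨m, h⟩) else (0 : k)
  map_add' f g := by
    ext m
    by_cases h : m < n + 1
    · simp only [dif_pos h, Pi.add_apply]; rfl
    · simp only [dif_neg h, Pi.add_apply, add_zero]
  map_smul' r f := by
    ext m
    by_cases h : m < n + 1
    · simp only [dif_pos h, Pi.smul_apply]; rfl
    · simp only [dif_neg h, Pi.smul_apply, smul_zero]

lemma evN_lt (n : ℕ) (f : PP k p n ⟶ ZZ k p) (i : Fin (n + 1)) :
    evN n f i = f.hom (ee n i) := dif_pos i.2

lemma evN_ge (n : ℕ) (f : PP k p n ⟶ ZZ k p) (m : ℕ) (h : n + 1 ≤ m) : evN n f m = 0 :=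
  dif_neg (Nat.not_lt.2 h)

lemma lft_triv (n : ℕ) (c : Fin (n + 1) → k) (z : Fin (n + 1) → R k p) :
    (lft n (ZZ k p) c).hom z = ∑ i, (∑ a, ∑ b, z i a b) * c i := by
  rw [lft_apply]
  simp [Finset.sum_mul]

lemma evN_ext (n : ℕ) (f g : PP k p n ⟶ ZZ k p) (h : ∀ j ≤ n, evN n f j = evN n g j) : f = g := by
  rw [hom_eq_lft n _ f, hom_eq_lft n _ g]
  congr 1
  funext i
  rw [← evN_lt, ← evN_lt, h _ (by omega)]

lemma evN_surj (n : ℕ) (c : ℕ → k) (h : ∀ m, n + 1 ≤ m → c m = 0) :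
    ∃ f : PP k p n ⟶ ZZ k p, evN n f = c := by
  refine ⟨lft n _ (fun i => c i), ?_⟩
  ext m
  by_cases hm : m < n + 1
  · have := evN_lt n (lft n (ZZ k p) (fun i => c i)) ⟨m, hm⟩
    rw [lft_ee] at this; exact this
  · rw [evN_ge _ _ _ (by omega), h _ (by omega)]

/-- cochain differential -/
def del (p n : ℕ) (c : ℕ → k) (j : ℕ) : k :=
  (if Even j ∧ 0 < j then p * c (j - 1) else 0) +
    (-1) ^ j * (if Even (n + 1 - j) then p * c j else 0)

lemma sum_ee (n : ℕ) (i j : Fin (n + 1)) :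
    ∑ a : ZMod p, ∑ b : ZMod p, (ee n i : Fin (n + 1) → R k p) j a b = if i = j then 1 else 0 := by
  rw [Finset.sum_eq_single 0, Finset.sum_eq_single 0, ee_apply]
  · simp
  · intro b _ hb; rw [ee_apply]; simp [hb]
  · simp
  · intro b _ hb; refine Finset.sum_eq_zero fun c _ => ?_
    rw [ee_apply]; simp [hb]
  · simp

lemma evN_d (n : ℕ) (f : PP k p n ⟶ ZZ k p) (j : ℕ) (hj : j ≤ n + 1) :
    evN (n + 1) (dR k p n ≫ f) j = del p n (evN n f) j := by
  have h1 := evN_lt (n + 1) (dR k p n ≫ f) ⟨j, by omega⟩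
  refine h1.trans ?_
  rw [Rep.hom_comp, Representation.IntertwiningMap.comp_apply, dR_apply]
  conv_lhs => rw [hom_eq_lft n _ f]
  rw [lft_triv]
  simp only [dT_apply, Pi.add_apply, Pi.smul_apply, Finset.sum_add_distrib, ← Finset.smul_sum]
  simp only [sum_D1, sum_D2, sum_ee, add_mul, Finset.sum_add_distrib]
  rw [del]
  congr 1
  · rcases j with _ | j
    · rw [if_neg (by simp)]
      refine Finset.sum_eq_zero fun i _ => ?_
      have : ¬ ((⟨0, by omega⟩ : Fin (n + 2)) = i.succ) := by
        rw [Fin.ext_iff, Fin.val_succ]; exact (Nat.succ_ne_zero _).symm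
      rw [if_neg this]; simp
    · rw [Finset.sum_eq_single ⟨j, by omega⟩]
      · have e := evN_lt n f ⟨j, by omega⟩
        simp only at e
        simp [ite_mul, e]
      · intro i _ hi
        have : ¬ ((⟨j + 1, by omega⟩ : Fin (n + 2)) = i.succ) := by
          intro h; apply hi; simp [Fin.ext_iff] at h ⊢; omega
        rw [if_neg this]; simp
      · simp
  · by_cases hj' : j < n + 1
    · rw [Finset.sum_eq_single ⟨j, hj'⟩]
      · have e := evN_lt n f ⟨j, hj'⟩
        simp only at e
        simp [ite_mul, mul_assoc, e]
      · intro i _ hi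
        have : ¬ ((⟨j, by omega⟩ : Fin (n + 2)) = i.castSucc) := by
          intro h; apply hi; simp [Fin.ext_iff] at h ⊢; omega
        rw [if_neg this]; simp
      · simp
    · rw [evN_ge _ _ _ (by omega)]
      simp only [mul_zero, ite_self]
      refine Finset.sum_eq_zero fun i _ => ?_
      have : ¬ ((⟨j, by omega⟩ : Fin (n + 2)) = i.castSucc) := by
          intro h; simp [Fin.ext_iff] at h; omega
      rw [if_neg this]; simp

lemma coh_equiv (n : ℕ) {A : Type} [AddCommGroup A] [Module k A] (φ : (ℕ → k) →ₗ[k] A)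
    (h1 : ∀ a, ∃ c : ℕ → k, (∀ m, n + 2 ≤ m → c m = 0) ∧ (∀ j ≤ n + 2, del p (n + 1) c j = 0) ∧
      φ c = a)
    (h2 : ∀ c : ℕ → k, (∀ m, n + 2 ≤ m → c m = 0) → (∀ j ≤ n + 2, del p (n + 1) c j = 0) →
      φ c = 0 → ∃ y : ℕ → k, (∀ m, n + 1 ≤ m → y m = 0) ∧ ∀ j ≤ n + 1, del p n y j = c j)
    (h3 : ∀ c y : ℕ → k, (∀ m, n + 2 ≤ m → c m = 0) → (∀ m, n + 1 ≤ m → y m = 0) →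
      (∀ j ≤ n + 1, del p n y j = c j) → φ c = 0) :
    Nonempty (groupCohomology (Rep.trivial k (GG p) k) (n + 1) ≃+ A) := by
  let K := (res k p).complex.linearYonedaObj k (ZZ k p)
  have hd : ∀ m (f : PP k p m ⟶ ZZ k p), K.d m (m + 1) f = dR k p m ≫ f := by
    intro m f
    rw [← CC_d]; rfl
  let S := K.sc' n (n + 1) (n + 2)
  obtain ⟨e⟩ : Nonempty (S.homology ≃+ A) := by
    refine homology_equiv S (φ ∘ₗ evN (n + 1)) ?_ ?_
    · intro a
      obtain ⟨c, hc, hc', rfl⟩ := h1 a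
      obtain ⟨f, hf⟩ := evN_surj (p := p) (n + 1) c hc
      refine ⟨f, (hd _ f).trans ?_, congrArg φ hf⟩
      refine evN_ext _ _ _ fun j hj => ?_
      rw [evN_d _ _ _ hj, hf, hc' j hj]
      exact (congrFun (map_zero (evN (n + 1 + 1))) j).symm
    · intro (f : PP k p (n + 1) ⟶ ZZ k p) hf
      have hf' : dR k p (n + 1) ≫ f = 0 := (hd _ f).symm.trans hf
      change φ (evN (n + 1) f) = 0 ↔ _
      constructor
      · intro h
        obtain ⟨y, hy, hy'⟩ := h2 _ (evN_ge _ f) (fun j hj => by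
          rw [← evN_d _ _ _ hj, hf']
          exact congrFun (map_zero (evN (n + 1 + 1))) j) h
        obtain ⟨g, hg⟩ := evN_surj (p := p) n y hy
        refine ⟨g, (hd _ g).trans (evN_ext _ _ _ fun j hj => ?_)⟩
        rw [evN_d _ _ _ hj, hg, hy' j hj]
      · rintro ⟨(g : PP k p n ⟶ ZZ k p), hg⟩
        have hg' : dR k p n ≫ g = f := (hd _ g).symm.trans hg
        refine h3 _ (evN n g) (evN_ge _ f) (evN_ge _ g) fun j hj => ?_
        rw [← evN_d _ _ _ hj, hg']
  have i1 := groupCohomologyIso (ZZ k p) (n + 1) (res k p)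
  have i2 := K.homologyIsoSc' n (n + 1) (n + 2) (by simp) (by simp)
  exact ⟨(i1 ≪≫ i2).toLinearEquiv.toAddEquiv.trans e⟩

end coh
end ZPSq

namespace ZPSq
open CategoryTheory
section final

lemma del_of_even {p N : ℕ} (hN : Even N) (y : ℕ → ℤ) (j : ℕ) (hj : j ≤ N + 1) :
    del p N y j = if Even j then (if 0 < j then p * y (j - 1) else 0) else -(p * y j) := by
  unfold del
  by_cases h : Even j
  · have h' : ¬ Even (N + 1 - j) := by
      rw [Nat.even_sub hj]; simp [hN, h, parity_simps]
    simp [h, h']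
  · have h' : Even (N + 1 - j) := by
      rw [Nat.even_sub hj]; simp [hN, h, parity_simps]
    simp [h, h', (Nat.not_even_iff_odd.1 h).neg_one_pow]

lemma del_of_odd {p N : ℕ} (hN : ¬ Even N) (y : ℕ → ℤ) (j : ℕ) (hj : j ≤ N + 1) :
    del p N y j = if Even j then (if 0 < j then p * y (j - 1) else 0) + p * y j else 0 := by
  unfold del
  by_cases h : Even j
  · have h' : Even (N + 1 - j) := by
      rw [Nat.even_sub hj]; simp [hN, h, parity_simps]
    simp [h, h', h.neg_one_pow]
  · have h' : ¬ Even (N + 1 - j) := by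
      rw [Nat.even_sub hj]; simp [hN, h, parity_simps]
    simp [h, h']

/-- reading off coordinates mod p -/
def rd (p s k : ℕ) : (ℕ → ℤ) →ₗ[ℤ] (Fin k → ZMod p) where
  toFun c m := (c (2 * m + s) : ZMod p)
  map_add' c d := by ext m; simp
  map_smul' r c := by ext m; simp

lemma rd_eq_zero {p s k : ℕ} {c : ℕ → ℤ} (h : rd p s k c = 0) (m : ℕ) (hm : m < k) :
    c (2 * m + s) = p * (c (2 * m + s) / p) := by
  have := congrFun h ⟨m, hm⟩
  change (c (2 * m + s) : ZMod p) = 0 at this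
  rw [ZMod.intCast_zmod_eq_zero_iff_dvd] at this
  exact (Int.mul_ediv_cancel' this).symm

lemma rd_zero {p s k : ℕ} {c : ℕ → ℤ} (h : ∀ m < k, (p : ℤ) ∣ c (2 * m + s)) :
    rd p s k c = 0 := by
  ext m
  change (c (2 * m + s) : ZMod p) = 0
  rw [ZMod.intCast_zmod_eq_zero_iff_dvd]
  exact h m m.2

lemma exists_lift (p k : ℕ) (a : Fin k → ZMod p) :
    ∃ b : ℕ → ℤ, (∀ m : Fin k, (b m : ZMod p) = a m) ∧ ∀ m, k ≤ m → b m = 0 := by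
  choose l hl using ZMod.intCast_surjective (n := p)
  refine ⟨fun m => if h : m < k then l (a ⟨m, h⟩) else 0, fun m => ?_, fun m hm => ?_⟩
  · simp [hl]
  · simp [Nat.not_lt.2 hm]

lemma odd_equiv (p : ℕ) [NeZero p] (k : ℕ) :
    Nonempty (groupCohomology (Rep.trivial ℤ (GG p) ℤ) (2 * k + 1) ≃+ (Fin k → ZMod p)) := by
  have hp : (p : ℤ) ≠ 0 := Nat.cast_ne_zero.2 (NeZero.ne p)
  have hE : Even (2 * k) := even_two_mul k
  have hO : ¬ Even (2 * k + 1) := by simp [parity_simps]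
  refine coh_equiv (2 * k) (rd p 2 k) ?_ ?_ ?_
  · intro a
    obtain ⟨b, hb, hb'⟩ := exists_lift p k a
    refine ⟨fun j => if j = 0 then 0 else if Even j then b (j / 2 - 1) else - b (j / 2), ?_, ?_, ?_⟩
    · intro m hm
      have h1 : b (m / 2 - 1) = 0 := hb' _ (by omega)
      have h2 : b (m / 2) = 0 := hb' _ (by omega)
      simp [h1, h2]
    · intro j hj
      rw [del_of_odd hO _ _ hj]
      by_cases h : Even j
      · obtain ⟨r, rfl⟩ := h
        rcases r with _ | r
        · simp
        · have e1 : (r + 1 + (r + 1) - 1) / 2 = r := by omega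
          have e2 : (r + 1 + (r + 1)) / 2 - 1 = r := by omega
          have e3 : ¬ Even (r + 1 + (r + 1) - 1) := by rw [Nat.even_iff]; omega
          have e4 : Even (r + 1 + (r + 1)) := ⟨_, rfl⟩
          have e5 : r + 1 + (r + 1) - 1 ≠ 0 := by omega
          simp only [if_neg e3, if_pos e4, e1, e2, if_neg e5]
          simp
      · simp [h]
    · ext m
      rw [← hb m]
      change (((if _ then _ else _ : ℤ)) : ZMod p) = _
      have e4 : Even (2 * (m : ℕ) + 2) := ⟨m + 1, by ring⟩
      have e2 : (2 * (m : ℕ) + 2) / 2 - 1 = m := by omega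
      rw [if_neg (by omega), if_pos e4, e2]
  · intro c hc hc' h0
    have hz : ∀ r, r ≤ k → c (2 * r + 1) = - c (2 * r + 2) := by
      intro r hr
      have := hc' (2 * r + 2) (by omega)
      rw [del_of_odd hO _ _ (by omega), if_pos ⟨r + 1, by ring⟩, if_pos (by omega),
        show 2 * r + 2 - 1 = 2 * r + 1 by omega, ← mul_add] at this
      have := (mul_eq_zero.1 this).resolve_left hp
      linarith
    have hz0 : c 0 = 0 := by
      have := hc' 0 (by omega)
      rw [del_of_odd hO _ _ (by omega)] at this
      simpa [NeZero.ne p] using this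
    refine ⟨fun j => if Even j then 0 else c (j + 1) / p, ?_, ?_⟩
    · intro m hm
      simp [hc (m + 1) (by omega)]
    · intro j hj
      rw [del_of_even hE _ _ hj]
      have key : ∀ r, r ≤ k → c (2 * r + 2) = p * (c (2 * r + 2) / p) := by
        intro r hr
        by_cases h : r < k
        · exact rd_eq_zero h0 r h
        · rw [hc _ (by omega)]; simp
      by_cases h : Even j
      · obtain ⟨r, rfl⟩ := h
        rcases r with _ | r
        · simp [hz0]
        · rw [if_pos ⟨_, rfl⟩, if_pos (by omega),
            show r + 1 + (r + 1) - 1 = 2 * r + 1 by omega,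
            if_neg (by rw [Nat.even_iff]; omega),
            show r + 1 + (r + 1) = 2 * r + 2 by omega]
          exact (key r (by omega)).symm
      · rw [if_neg h, if_neg h]
        obtain ⟨r, rfl⟩ := Nat.not_even_iff_odd.1 h
        rw [hz r (by omega), ← key r (by omega)]
  · intro c y hc hy h
    refine rd_zero fun m hm => ?_
    rw [← h _ (by omega), del_of_even hE _ _ (by omega), if_pos ⟨m + 1, by ring⟩,
      if_pos (by omega)]
    exact dvd_mul_right _ _

lemma even_equiv (p : ℕ) [NeZero p] (l : ℕ) :
    Nonempty (groupCohomology (Rep.trivial ℤ (GG p) ℤ) (2 * l + 1 + 1) ≃+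
      (Fin (l + 2) → ZMod p)) := by
  have hp : (p : ℤ) ≠ 0 := Nat.cast_ne_zero.2 (NeZero.ne p)
  have hE : Even (2 * l + 1 + 1) := ⟨l + 1, by ring⟩
  have hO : ¬ Even (2 * l + 1) := by simp [parity_simps]
  refine coh_equiv (2 * l + 1) (rd p 0 (l + 2)) ?_ ?_ ?_
  · intro a
    obtain ⟨b, hb, hb'⟩ := exists_lift p (l + 2) a
    refine ⟨fun j => if Even j then b (j / 2) else 0, ?_, ?_, ?_⟩
    · intro m hm
      by_cases h : Even m
      · obtain ⟨r, rfl⟩ := h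
        simp [hb' ((r + r) / 2) (by omega)]
      · simp [h]
    · intro j hj
      rw [del_of_even hE _ _ hj]
      by_cases h : Even j
      · rw [if_pos h]
        split_ifs with h1 h2
        · rw [Nat.even_iff] at h h2; omega
        · simp
        · rfl
      · simp [h]
    · ext m
      rw [← hb m]
      change (((if _ then _ else _ : ℤ)) : ZMod p) = _
      have e4 : Even (2 * (m : ℕ) + 0) := ⟨m, by ring⟩
      have e2 : (2 * (m : ℕ) + 0) / 2 = m := by omega
      rw [if_pos e4, e2]
  · intro c hc hc' h0
    have hz : ∀ r, r ≤ l → c (2 * r + 1) = 0 := by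
      intro r hr
      have := hc' (2 * r + 1) (by omega)
      rw [del_of_even hE _ _ (by omega), if_neg (by simp [parity_simps])] at this
      exact (mul_eq_zero.1 (neg_eq_zero.1 this)).resolve_left hp
    have key : ∀ r, r ≤ l + 1 → c (2 * r) = p * (c (2 * r) / p) := by
      intro r hr
      exact rd_eq_zero h0 r (by omega)
    refine ⟨fun j => if j < 2 * l + 1 then (if Even j then c j / p else 0) else
      if j = 2 * l + 1 then c (j + 1) / p else 0, ?_, ?_⟩
    · intro m hm
      beta_reduce
      rw [if_neg (by omega), if_neg (by omega)]
    · intro j hj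
      rw [del_of_odd hO _ _ hj]
      by_cases h : Even j
      · obtain ⟨r, rfl⟩ := h
        have hk := key r (by omega)
        rw [← two_mul] at *
        rw [if_pos (even_two_mul r)]
        rcases r with _ | r
        · simp only [mul_zero] at hk ⊢
          simp
          exact hk.symm
        · rw [if_pos (by omega)]
          by_cases hr : r < l
          · rw [if_pos (by omega), if_neg (by rw [Nat.even_iff]; omega), if_pos (by omega),
              if_pos (even_two_mul _), ← hk]
            simp
          · rw [if_neg (by omega), if_pos (by omega), if_neg (by omega), if_neg (by omega),
              show 2 * (r + 1) - 1 + 1 = 2 * (r + 1) by omega, ← hk]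
            simp
      · obtain ⟨r, rfl⟩ := Nat.not_even_iff_odd.1 h
        rw [if_neg h, hz r (by omega)]
  · intro c y hc hy h
    refine rd_zero fun m hm => ?_
    rw [← h _ (by omega), del_of_odd hO _ _ (by omega), if_pos ⟨m, by ring⟩]
    split_ifs
    · exact dvd_add (dvd_mul_right _ _) (dvd_mul_right _ _)
    · rw [zero_add]; exact dvd_mul_right _ _

end final
end ZPSq

/-- For an odd prime `p` and `G = (ZMod p) × (ZMod p)`, the group cohomology
of `G` with coefficients in the trivial `G`-module `ℤ` satisfies `H⁰(G;ℤ) ≅ ℤ`, `H¹(G;ℤ) = 0`,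
`H^{2k}(G;ℤ) ≅ (ZMod p)^{k+1}` for `k ≥ 1`, and `H^{2k+1}(G;ℤ) ≅ (ZMod p)^{k}` for `k ≥ 1`. -/
theorem groupCohomology_ZmodP_sq (p : ℕ) (hp : p.Prime) (hodd : Odd p) :
    Nonempty ((groupCohomology
        (Rep.trivial ℤ (Multiplicative (ZMod p × ZMod p)) ℤ) 0) ≃+ ℤ) ∧
      Subsingleton (groupCohomology
        (Rep.trivial ℤ (Multiplicative (ZMod p × ZMod p)) ℤ) 1) ∧
      (∀ k : ℕ, 1 ≤ k → Nonempty ((groupCohomology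
        (Rep.trivial ℤ (Multiplicative (ZMod p × ZMod p)) ℤ) (2 * k)) ≃+
          (Fin (k + 1) → ZMod p))) ∧
      (∀ k : ℕ, 1 ≤ k → Nonempty ((groupCohomology
        (Rep.trivial ℤ (Multiplicative (ZMod p × ZMod p)) ℤ) (2 * k + 1)) ≃+
          (Fin k → ZMod p))) := by
  haveI : NeZero p := ⟨hp.ne_zero⟩
  refine ⟨?_, ?_, ?_, ?_⟩
  · exact ⟨(groupCohomology.H0IsoOfIsTrivial
      (Rep.trivial ℤ (Multiplicative (ZMod p × ZMod p)) ℤ)).toLinearEquiv.toAddEquiv⟩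
  · obtain ⟨e⟩ := ZPSq.odd_equiv p 0
    exact e.toEquiv.subsingleton
  · intro k hk
    obtain ⟨l, rfl⟩ : ∃ l, k = l + 1 := ⟨k - 1, by omega⟩
    exact ZPSq.even_equiv p l
  · intro k _
    exact ZPSq.odd_equiv p k
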